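/- arXiv:1808.07890 — 2 statements merged into one kernel-verified Lean document; each statement's English description precedes it below -/
import Mathlib

section
/- Let X be a regular topological space and {Z_n} random variables taking values in X. Let I : X → [0,∞] be a lower semi-continuous rate function with compact level sets Ψ(α) = {x : I(x) ≤ α}. Suppose that for all closed sets A ⊆ X, limsup_{n→∞} (1/n) log P[Z_n ∈ A] ≤ −inf_{x∈A} I(x). Let φ : X → [−∞, ∞) be upper semi-continuous and A ⊆ X a Borel set such that A ∩ {x : φ(x) ≥ −α} is closed for each α < ∞, and suppose C(γ) := limsup_{n→∞} (1/n) log E[e^{γ n φ(Z_n)} 1{Z_n ∈ A}] < ∞ for some γ > 1. Then limsup_{n→∞} (1/n) log E[e^{n φ(Z_n)} 1{Z_n ∈ A}] ≤ sup_{x∈A} (φ(x) − I(x)). -/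
open MeasureTheory Filter
open scoped ENNReal NNReal

noncomputable section

lemma limsup_inv_mul_log_eq_expGrowthSup (u : ℕ → ℝ≥0∞) :
    limsup (fun n : ℕ => ((n : ℝ)⁻¹ : EReal) * ENNReal.log (u n)) atTop =
      ExpGrowth.expGrowthSup u := by
  refine limsup_congr (Eventually.of_forall fun n => ?_)
  rw [mul_comm, div_eq_mul_inv]
  rfl

lemma expGrowthSup_exp_mul_le (d : ℝ) (u : ℕ → ℝ≥0∞) :
    ExpGrowth.expGrowthSup (fun n => EReal.exp ((d : EReal) * n) * u n) ≤
      d + ExpGrowth.expGrowthSup u := by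
  have hexp : ExpGrowth.expGrowthSup (fun n : ℕ => EReal.exp ((d : EReal) * n)) = d :=
    ExpGrowth.expGrowthSup_exp
  refine (ExpGrowth.expGrowthSup_mul_le ?_ ?_).trans_eq (by rw [hexp]) <;>
  · rw [hexp]
    simp

section LaplaceGrowth

variable {X : Type*} {Ω : ℕ → Type*} [∀ n, MeasurableSpace (Ω n)]

/-- The exponential growth rate of `E[e^{nφ(Z_n)}; Z_n ∈ S]`. -/
def laplaceGrowth (μ : ∀ n, Measure (Ω n)) (Z : ∀ n, Ω n → X) (φ : X → EReal) (S : Set X) :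
    EReal :=
  ExpGrowth.expGrowthSup fun n =>
    ∫⁻ ω in {ω | Z n ω ∈ S}, EReal.exp (((n : ℝ) : EReal) * φ (Z n ω)) ∂ μ n

variable {μ : ∀ n, Measure (Ω n)} {Z : ∀ n, Ω n → X} {φ : X → EReal} {S T : Set X}

lemma laplaceGrowth_mono (h : S ⊆ T) : laplaceGrowth μ Z φ S ≤ laplaceGrowth μ Z φ T :=
  ExpGrowth.expGrowthSup_monotone fun _ => lintegral_mono_set fun _ hω => h hω

lemma laplaceGrowth_union_le (S T : Set X) :
    laplaceGrowth μ Z φ (S ∪ T) ≤ laplaceGrowth μ Z φ S ⊔ laplaceGrowth μ Z φ T := by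
  unfold laplaceGrowth
  rw [← ExpGrowth.expGrowthSup_add]
  exact ExpGrowth.expGrowthSup_monotone fun n => lintegral_union_le _ _ _

lemma laplaceGrowth_le_add_of_forall_le {d : ℝ} (h : ∀ x ∈ S, φ x ≤ d) :
    laplaceGrowth μ Z φ S ≤
      d + ExpGrowth.expGrowthSup fun n => μ n {ω | Z n ω ∈ S} := by
  refine le_trans (ExpGrowth.expGrowthSup_monotone fun n => ?_) (expGrowthSup_exp_mul_le d _)
  dsimp only
  rw [← setLIntegral_const]
  refine setLIntegral_mono measurable_const fun ω hω => EReal.exp_monotone ?_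
  rw [mul_comm]
  exact mul_le_mul_of_nonneg_right (h _ hω) (Nat.cast_nonneg' n)

lemma laplaceGrowth_le_of_forall_le [∀ n, IsProbabilityMeasure (μ n)] {d : ℝ}
    (h : ∀ x ∈ S, φ x ≤ d) : laplaceGrowth μ Z φ S ≤ d := by
  refine (laplaceGrowth_le_add_of_forall_le h).trans ?_
  have : ExpGrowth.expGrowthSup (fun n => μ n {ω | Z n ω ∈ S}) ≤ 0 :=
    (ExpGrowth.expGrowthSup_monotone fun n => prob_le_one).trans_eq
      (ExpGrowth.expGrowthSup_const one_ne_zero ENNReal.one_ne_top)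
  exact (add_le_add le_rfl this).trans_eq (add_zero _)

/-- An exponential Chebyshev bound for the upper tail of `φ`. -/
lemma laplaceGrowth_le_of_forall_ge {γ M : ℝ} (hγ : 1 < γ) (hφtop : ∀ x, φ x ≠ ⊤)
    (hφZ : ∀ n, Measurable fun ω => φ (Z n ω)) (hST : S ⊆ T)
    (h : ∀ x ∈ S, (M : EReal) ≤ φ x) :
    laplaceGrowth μ Z φ S ≤ ((-((γ - 1) * M) : ℝ) : EReal) +
      ExpGrowth.expGrowthSup fun n : ℕ => ∫⁻ ω in {ω | Z n ω ∈ T},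
        EReal.exp (((γ * n : ℝ) : EReal) * φ (Z n ω)) ∂ μ n := by
  refine le_trans (ExpGrowth.expGrowthSup_monotone fun n => ?_) (expGrowthSup_exp_mul_le _ _)
  have hmeas : Measurable fun ω => EReal.exp (((γ * n : ℝ) : EReal) * φ (Z n ω)) :=
    ((hφZ n).const_mul _).ereal_exp
  dsimp only
  rw [← lintegral_const_mul _ hmeas]
  refine (setLIntegral_mono (hmeas.const_mul _) fun ω hω => ?_).trans
    (lintegral_mono_set fun ω hω => hST hω)
  rw [← EReal.exp_add]
  refine EReal.exp_monotone ?_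
  have hM := h _ hω
  lift φ (Z n ω) to ℝ using ⟨hφtop _, (EReal.bot_lt_coe M |>.trans_le hM).ne'⟩ with r
  rw [EReal.coe_le_coe_iff] at hM
  rw [← EReal.coe_natCast, ← EReal.coe_mul, ← EReal.coe_mul, ← EReal.coe_mul, ← EReal.coe_add,
    EReal.coe_le_coe_iff]
  nlinarith [mul_nonneg (mul_nonneg (sub_nonneg.2 hγ.le) (sub_nonneg.2 hM)) n.cast_nonneg (α := ℝ)]

end LaplaceGrowth

lemma neg_coe_iInf_le_of_forall_sub_le {X : Type*} {I : X → ℝ≥0∞} {S : Set X} {c b : ℝ}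
    (h : ∀ x ∈ S, (c : EReal) - I x ≤ b) :
    -((⨅ x ∈ S, I x : ℝ≥0∞) : EReal) ≤ ((b - c : ℝ) : EReal) := by
  have hinf : ENNReal.ofReal (c - b) ≤ ⨅ x ∈ S, I x := by
    refine le_iInf₂ fun x hx => ?_
    have hx' := h x hx
    rcases eq_or_ne (I x) ⊤ with htop | htop
    · simp [htop]
    · rw [← EReal.coe_ennreal_toReal htop, ← EReal.coe_sub, EReal.coe_le_coe_iff] at hx'
      rw [ENNReal.ofReal_le_iff_le_toReal htop]
      linarith
  rw [EReal.neg_le, ← EReal.coe_neg, neg_sub]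
  refine le_trans ?_ (EReal.coe_ennreal_le_coe_ennreal_iff.2 hinf)
  rw [EReal.coe_ennreal_ofReal]
  exact EReal.coe_le_coe_iff.2 (le_max_left _ _)

/-- **Lemma B.1 (Varadhan's lemma, upper bound).** Let `X` be a regular topological
space, `Z_n` Borel-measurable random variables with values in `X`, and `I` a lower
semi-continuous rate function with compact level sets, such that the large deviations
upper bound holds for all closed sets. If `φ : X → [−∞,∞)` is upper semi-continuous,
`A` is Borel with `A ∩ {φ ≥ −α}` closed for every real `α`, and
`limsup n⁻¹ log E[e^{γnφ(Z_n)} 1_A(Z_n)] < ∞` for some `γ > 1`, then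
`limsup n⁻¹ log E[e^{nφ(Z_n)} 1_A(Z_n)] ≤ sup_{x ∈ A} (φ(x) − I(x))`. -/
theorem varadhan_upper_bound
    {X : Type*} [TopologicalSpace X] [RegularSpace X]
    [MeasurableSpace X] [BorelSpace X]
    {Ω : ℕ → Type*} [∀ n, MeasurableSpace (Ω n)]
    (μ : ∀ n, Measure (Ω n)) (hμ : ∀ n, IsProbabilityMeasure (μ n))
    (Z : ∀ n, Ω n → X) (hZ : ∀ n, Measurable (Z n))
    (I : X → ℝ≥0∞) (hIlsc : LowerSemicontinuous I)
    (hIcompact : ∀ α : ℝ≥0∞, α ≠ ⊤ → IsCompact {x | I x ≤ α})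
    (hLDP : ∀ A : Set X, IsClosed A →
      limsup (fun n : ℕ => ((n : ℝ)⁻¹ : EReal) *
          ENNReal.log (μ n {ω | Z n ω ∈ A})) atTop
        ≤ -((⨅ x ∈ A, I x : ℝ≥0∞) : EReal))
    (φ : X → EReal) (hφtop : ∀ x, φ x ≠ ⊤) (hφusc : UpperSemicontinuous φ)
    (A : Set X) (hA : MeasurableSet A)
    (hAclosed : ∀ α : ℝ, IsClosed (A ∩ {x | -(α : EReal) ≤ φ x}))
    (hexp : ∃ γ : ℝ, 1 < γ ∧
      limsup (fun n : ℕ => ((n : ℝ)⁻¹ : EReal) *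
          ENNReal.log (∫⁻ ω in {ω | Z n ω ∈ A},
            EReal.exp (((γ * n : ℝ) : EReal) * φ (Z n ω)) ∂ μ n)) atTop < ⊤) :
    limsup (fun n : ℕ => ((n : ℝ)⁻¹ : EReal) *
        ENNReal.log (∫⁻ ω in {ω | Z n ω ∈ A},
          EReal.exp (((n : ℝ) : EReal) * φ (Z n ω)) ∂ μ n)) atTop
      ≤ ⨆ x ∈ A, (φ x - (I x : EReal)) := by
  have hφZ : ∀ n, Measurable fun ω => φ (Z n ω) := fun n => hφusc.measurable.comp (hZ n)
  obtain ⟨γ, hγ, hC⟩ := hexp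
  rw [limsup_inv_mul_log_eq_expGrowthSup] at hC ⊢
  simp only [limsup_inv_mul_log_eq_expGrowthSup] at hLDP
  change laplaceGrowth μ Z φ A ≤ _
  refine EReal.le_of_forall_lt_iff_le.1 fun b hb => ?_
  obtain ⟨b', hb', hb'b⟩ := EReal.exists_between_coe_real hb
  obtain ⟨C, hC, -⟩ := EReal.exists_between_coe_real hC
  rw [EReal.coe_lt_coe_iff] at hb'b
  have hslice (c : ℝ) :
      laplaceGrowth μ Z φ (A ∩ {x | (c : EReal) ≤ φ x ∧ φ x ≤ ((c + (b - b') : ℝ) : EReal)}) ≤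
        b := by
    refine (laplaceGrowth_le_add_of_forall_le fun x hx => hx.2.2).trans ?_
    have hclosed : IsClosed (A ∩ {x | (c : EReal) ≤ φ x}) := by
      simpa using hAclosed (-c)
    have hsub : A ∩ {x | (c : EReal) ≤ φ x ∧ φ x ≤ ((c + (b - b') : ℝ) : EReal)} ⊆
        A ∩ {x | (c : EReal) ≤ φ x} := fun x hx => ⟨hx.1, hx.2.1⟩
    have hprob := (hLDP _ hclosed).trans (neg_coe_iInf_le_of_forall_sub_le (c := c) (b := b')
      fun x hx => (EReal.sub_le_sub hx.2 le_rfl).trans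
        ((le_iSup₂ (f := fun x _ => φ x - (I x : EReal)) x hx.1).trans hb'.le))
    have hmono : ExpGrowth.expGrowthSup (fun n => μ n {ω | Z n ω ∈
        A ∩ {x | (c : EReal) ≤ φ x ∧ φ x ≤ ((c + (b - b') : ℝ) : EReal)}}) ≤
        ExpGrowth.expGrowthSup fun n => μ n {ω | Z n ω ∈ A ∩ {x | (c : EReal) ≤ φ x}} :=
      ExpGrowth.expGrowthSup_monotone fun n =>
        measure_mono (μ := μ n) (Set.preimage_mono (f := Z n) hsub)
    refine (add_le_add le_rfl (hmono.trans hprob)).trans_eq ?_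
    rw [← EReal.coe_add]
    congr 1
    ring
  have hlow (k : ℕ) :
      laplaceGrowth μ Z φ (A ∩ {x | φ x ≤ ((b + k * (b - b') : ℝ) : EReal)}) ≤ b := by
    induction k with
    | zero => exact laplaceGrowth_le_of_forall_le fun x hx => by simpa using hx.2
    | succ k ih =>
      refine (laplaceGrowth_mono ?_).trans ((laplaceGrowth_union_le _ _).trans
        (sup_le ih (hslice (b + k * (b - b')))))
      rintro x ⟨hxA, hx⟩
      rcases le_total (φ x) ((b + k * (b - b') : ℝ) : EReal) with h | h
      · exact Or.inl ⟨hxA, h⟩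
      · refine Or.inr ⟨hxA, h, hx.trans_eq ?_⟩
        congr 1
        push_cast
        ring
  obtain ⟨k, hk⟩ := exists_nat_ge (((C - b) / (γ - 1) - b) / (b - b'))
  have hM : (C - b) / (γ - 1) ≤ b + k * (b - b') := by
    rw [div_le_iff₀ (sub_pos.2 hb'b)] at hk
    linarith
  rw [div_le_iff₀ (sub_pos.2 hγ)] at hM
  set M : ℝ := b + k * (b - b')
  have htail : laplaceGrowth μ Z φ (A ∩ {x | (M : EReal) ≤ φ x}) ≤ b := by
    refine (laplaceGrowth_le_of_forall_ge hγ hφtop hφZ Set.inter_subset_left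
      fun x hx => hx.2).trans ((add_le_add le_rfl hC.le).trans ?_)
    rw [← EReal.coe_add, EReal.coe_le_coe_iff]
    linarith
  refine (laplaceGrowth_mono ?_).trans
    ((laplaceGrowth_union_le _ _).trans (sup_le (hlow k) htail))
  intro x hx
  exact (le_total (φ x) M).imp (fun h => ⟨hx, h⟩) fun h => ⟨hx, h⟩

end
end

section
/- (a) For any constants η > 0 and β > 0, there exists a constant C = C(β,η) < ∞ such that J(ρ, y) ≤ C + y²/(4β²) for all ρ ∈ P with Q(ρ) ≥ η and all y ∈ ℝ. (b) The functional J : {ρ ∈ P : Q(ρ) > 0} × ℝ → [−∞, ∞) is upper semi-continuous (with respect to the weak topology on P and the usual topology on ℝ). -/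
open MeasureTheory ProbabilityTheory Real Filter
open scoped ENNReal NNReal Classical

noncomputable section

/-- The open interval `(−1,1)` as a type. -/
abbrev Int11 : Type := ↥(Set.Ioo (-1 : ℝ) 1)

/-- Inverse hyperbolic tangent. -/
def atanh (x : ℝ) : ℝ := Real.log ((1 + x) / (1 - x)) / 2

/-- `Q(ρ) = ∫ x² ρ(dx)`. -/
def Qm (ρ : ProbabilityMeasure Int11) : ℝ := ∫ x, (x : ℝ) ^ 2 ∂(ρ : Measure Int11)

/-- `M(ρ) = ∫ x ρ(dx)`. -/
def Mm (ρ : ProbabilityMeasure Int11) : ℝ := ∫ x, (x : ℝ) ∂(ρ : Measure Int11)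

/-- `g(x; φ, q, y)`. -/
def gdens (β lam x φ q y : ℝ) : ℝ :=
  (1 - x ^ 2)⁻¹ *
    Real.exp (-(atanh x - β * lam * φ + β ^ 2 * (1 - q) * x - y * x) ^ 2 / (2 * β ^ 2 * q))

/-- The extended-real functional
`J(ρ,y) = β²(1−Q(ρ))²/2 − (1/2)log(2πβ²Q(ρ)) + ∫ log g(x; M(ρ), Q(ρ), y) ρ(dx)`,
where the integral may equal `−∞` (it is split into positive and negative parts). -/
def JE (β lam : ℝ) (ρ : ProbabilityMeasure Int11) (y : ℝ) : EReal :=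
  ((β ^ 2 * (1 - Qm ρ) ^ 2 / 2 - Real.log (2 * π * β ^ 2 * Qm ρ) / 2 : ℝ) : EReal)
  + ((∫⁻ x, ENNReal.ofReal (Real.log (gdens β lam x (Mm ρ) (Qm ρ) y))
        ∂(ρ : Measure Int11) : ℝ≥0∞) : EReal)
  - ((∫⁻ x, ENNReal.ofReal (-Real.log (gdens β lam x (Mm ρ) (Qm ρ) y))
        ∂(ρ : Measure Int11) : ℝ≥0∞) : EReal)

lemma neg_log_one_sub_sq_le {x : ℝ} (hx : x ∈ Set.Ioo (-1 : ℝ) 1) :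
    -Real.log (1 - x ^ 2) ≤ 2 * |atanh x| := by
  obtain ⟨h1, h2⟩ := hx
  have hp : 0 < 1 + x := by linarith
  have hm : 0 < 1 - x := by linarith
  have e : Real.log (1 - x ^ 2) = Real.log (1 + x) + Real.log (1 - x) := by
    rw [← Real.log_mul hp.ne' hm.ne']
    ring_nf
  have e2 : 2 * atanh x = Real.log (1 + x) - Real.log (1 - x) := by
    rw [atanh, Real.log_div hp.ne' hm.ne']
    ring
  rcases le_total 0 x with h | h
  · have := Real.log_nonneg (by linarith : 1 ≤ 1 + x)
    have := le_abs_self (atanh x)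
    linarith
  · have := Real.log_nonneg (by linarith : 1 ≤ 1 - x)
    have := neg_le_abs (atanh x)
    linarith

lemma log_gdens (β lam φ q y : ℝ) {x : ℝ} (hx : x ∈ Set.Ioo (-1 : ℝ) 1) :
    Real.log (gdens β lam x φ q y) = -Real.log (1 - x ^ 2) +
      -(atanh x - β * lam * φ + β ^ 2 * (1 - q) * x - y * x) ^ 2 / (2 * β ^ 2 * q) := by
  have h : 0 < 1 - x ^ 2 := by nlinarith [hx.1, hx.2]
  rw [gdens, Real.log_mul (inv_pos.2 h).ne' (Real.exp_pos _).ne', Real.log_exp, Real.log_inv]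

/-- A constant which, up to the term `y² / (4β²)`, bounds `log g` from above. -/
def gbound (β lam y : ℝ) : ℝ :=
  6 * β ^ 2 + 2 * (β * lam + β ^ 2) + y ^ 2 / (4 * β ^ 2)

lemma gbound_nonneg {β lam : ℝ} (hβ : 0 < β) (hlam : 0 ≤ lam) (y : ℝ) : 0 ≤ gbound β lam y := by
  unfold gbound
  positivity

lemma log_gdens_le {β lam φ q x : ℝ} (hβ : 0 < β) (hlam : 0 ≤ lam) (y : ℝ)
    (hx : x ∈ Set.Ioo (-1 : ℝ) 1) (hφ : |φ| ≤ 1) (hq : q ∈ Set.Ioc (0 : ℝ) 1) :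
    Real.log (gdens β lam x φ q y) ≤ gbound β lam y := by
  obtain ⟨hq0, hq1⟩ := hq
  have hx1 : |x| ≤ 1 := abs_le.2 ⟨hx.1.le, hx.2.le⟩
  rw [log_gdens _ _ _ _ _ hx, gbound]
  set u := atanh x - β * lam * φ + β ^ 2 * (1 - q) * x - y * x with hu
  have ha : |atanh x| ≤ |u| + β * lam + β ^ 2 + |y| := by
    have e : atanh x = u + β * lam * φ + -(β ^ 2 * (1 - q) * x) + y * x := by rw [hu]; ring
    have b1 : |β * lam * φ| ≤ β * lam := by
      rw [abs_mul, abs_of_nonneg (by positivity : 0 ≤ β * lam)]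
      exact mul_le_of_le_one_right (by positivity) hφ
    have b2 : |-(β ^ 2 * (1 - q) * x)| ≤ β ^ 2 := by
      have h1 : 0 ≤ 1 - q := by linarith
      rw [abs_neg, abs_mul, abs_of_nonneg (by positivity : 0 ≤ β ^ 2 * (1 - q)), mul_assoc]
      exact mul_le_of_le_one_right (by positivity)
        (mul_le_one₀ (by linarith) (abs_nonneg x) hx1)
    have b3 : |y * x| ≤ |y| := by
      rw [abs_mul]
      exact mul_le_of_le_one_right (abs_nonneg y) hx1
    have t1 := abs_add_le (u + β * lam * φ + -(β ^ 2 * (1 - q) * x)) (y * x)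
    have t2 := abs_add_le (u + β * lam * φ) (-(β ^ 2 * (1 - q) * x))
    have t3 := abs_add_le u (β * lam * φ)
    rw [← e] at t1
    linarith
  have hu2 : 2 * |u| + -u ^ 2 / (2 * β ^ 2 * q) ≤ 2 * β ^ 2 := by
    have hu3 : 2 * |u| - 2 * β ^ 2 * q ≤ u ^ 2 / (2 * β ^ 2 * q) := by
      rw [le_div_iff₀ (by positivity), ← sq_abs u]
      nlinarith [sq_nonneg (|u| - 2 * β ^ 2 * q)]
    have : β ^ 2 * q ≤ β ^ 2 := mul_le_of_le_one_right (by positivity) hq1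
    rw [neg_div]
    linarith
  have hy : 2 * |y| ≤ 4 * β ^ 2 + y ^ 2 / (4 * β ^ 2) := by
    have : 2 * |y| - 4 * β ^ 2 ≤ y ^ 2 / (4 * β ^ 2) := by
      rw [le_div_iff₀ (by positivity), ← sq_abs y]
      nlinarith [sq_nonneg (|y| - 4 * β ^ 2)]
    linarith
  linarith [neg_log_one_sub_sq_le hx]

lemma continuous_atanh_coe : Continuous fun x : Int11 => atanh (x : ℝ) := by
  unfold atanh
  have h (x : Int11) : 0 < 1 + (x : ℝ) ∧ 0 < 1 - (x : ℝ) :=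
    ⟨by linarith [x.2.1], by linarith [x.2.2]⟩
  refine (Continuous.log (Continuous.div (by fun_prop) (by fun_prop) fun x => (h x).2.ne')
    fun x => (div_pos (h x).1 (h x).2).ne').div_const _

/-- The parameter space of triples `(φ, q, y)` with `|φ| ≤ 1` and `0 < q ≤ 1`. -/
abbrev GParam : Type := ↥(Set.Icc (-1 : ℝ) 1) × ↥(Set.Ioc (0 : ℝ) 1) × ℝ

lemma continuous_log_gdens {β : ℝ} (hβ : 0 < β) (lam : ℝ) :
    Continuous fun p : Int11 × GParam =>
      Real.log (gdens β lam p.1 p.2.1 p.2.2.1 p.2.2.2) := by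
  simp_rw [fun p : Int11 × GParam => log_gdens β lam p.2.1 p.2.2.1 p.2.2.2 p.1.2]
  have ha : Continuous fun p : Int11 × GParam => atanh (p.1 : ℝ) :=
    continuous_atanh_coe.comp continuous_fst
  refine Continuous.add (Continuous.neg (Continuous.log (by fun_prop) fun p => ?_))
    (Continuous.div (by fun_prop) (by fun_prop) fun p => ?_)
  · nlinarith [p.1.2.1, p.1.2.2]
  · have := p.2.2.1.2.1
    positivity

lemma ofReal_eq_iSup_min (a : ℝ) :
    ENNReal.ofReal a = ⨆ n : ℕ, ENNReal.ofReal (min a n) := by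
  refine le_antisymm ?_ (iSup_le fun n => ENNReal.ofReal_le_ofReal (min_le_left _ _))
  obtain ⟨n, hn⟩ := exists_nat_ge a
  exact le_iSup_of_le n (by rw [min_eq_left hn])

lemma lowerSemicontinuous_lintegral_ofReal {Ω : Type*} [TopologicalSpace Ω] [MeasurableSpace Ω]
    [OpensMeasurableSpace Ω] {f : Ω → ℝ} (hf : Continuous f) :
    LowerSemicontinuous fun μ : ProbabilityMeasure Ω =>
      ∫⁻ x, ENNReal.ofReal (f x) ∂(μ : Measure Ω) := by
  have hm (n : ℕ) : Continuous fun x => ENNReal.ofReal (min (f x) n) :=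
    ENNReal.continuous_ofReal.comp (by fun_prop)
  have e (μ : ProbabilityMeasure Ω) : ∫⁻ x, ENNReal.ofReal (f x) ∂(μ : Measure Ω) =
      ⨆ n : ℕ, ∫⁻ x, ENNReal.ofReal (min (f x) n) ∂(μ : Measure Ω) := by
    simp_rw [ofReal_eq_iSup_min (f _)]
    refine lintegral_iSup (fun n => (hm n).measurable) fun m n hmn x => ?_
    exact ENNReal.ofReal_le_ofReal (min_le_min_left _ (Nat.cast_le.2 hmn))
  simp_rw [e]
  refine lowerSemicontinuous_iSup fun n => Continuous.lowerSemicontinuous ?_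
  let g : BoundedContinuousFunction Ω ℝ≥0 :=
    BoundedContinuousFunction.mkOfBound ⟨fun x => Real.toNNReal (min (f x) n), by fun_prop⟩ n
      fun x y => by
        have h (z : Ω) : ((Real.toNNReal (min (f z) n) : ℝ≥0) : ℝ) ≤ n := by
          rw [Real.coe_toNNReal']
          exact max_le (min_le_right _ _) (Nat.cast_nonneg n)
        rw [NNReal.dist_eq]
        exact abs_sub_le_of_nonneg_of_le (NNReal.coe_nonneg _) (h x) (NNReal.coe_nonneg _) (h y)
  rw [continuous_iff_continuousAt]
  intro μ
  exact (ProbabilityMeasure.tendsto_iff_forall_lintegral_tendsto.1 tendsto_id) g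

lemma continuous_Qm : Continuous Qm := by
  rw [continuous_iff_continuousAt]
  intro μ
  exact (ProbabilityMeasure.tendsto_iff_forall_integral_tendsto.1 tendsto_id)
    (BoundedContinuousFunction.ofNormedAddCommGroup (fun x : Int11 => (x : ℝ) ^ 2) (by fun_prop) 1
      fun x => by
        rw [Real.norm_eq_abs, abs_pow]
        exact pow_le_one₀ (abs_nonneg _) (abs_le.2 ⟨x.2.1.le, x.2.2.le⟩))

lemma continuous_Mm : Continuous Mm := by
  rw [continuous_iff_continuousAt]
  intro μ
  exact (ProbabilityMeasure.tendsto_iff_forall_integral_tendsto.1 tendsto_id)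
    (BoundedContinuousFunction.ofNormedAddCommGroup (fun x : Int11 => (x : ℝ)) (by fun_prop) 1
      fun x => by
        rw [Real.norm_eq_abs]
        exact abs_le.2 ⟨x.2.1.le, x.2.2.le⟩)

lemma abs_Mm_le (ρ : ProbabilityMeasure Int11) : |Mm ρ| ≤ 1 := by
  have := norm_integral_le_of_norm_le_const (μ := (ρ : Measure Int11)) (C := 1)
    (f := fun x : Int11 => (x : ℝ))
    (Eventually.of_forall fun x => abs_le.2 ⟨x.2.1.le, x.2.2.le⟩)
  simpa [Mm] using this

lemma Qm_le_one (ρ : ProbabilityMeasure Int11) : Qm ρ ≤ 1 := by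
  have := norm_integral_le_of_norm_le_const (μ := (ρ : Measure Int11)) (C := 1)
    (f := fun x : Int11 => (x : ℝ) ^ 2)
    (Eventually.of_forall fun x => by
      rw [Real.norm_eq_abs, abs_pow]
      exact pow_le_one₀ (abs_nonneg _) (abs_le.2 ⟨x.2.1.le, x.2.2.le⟩))
  exact (le_abs_self _).trans (by simpa [Qm] using this)

/-- The parameters `(M(ρ), Q(ρ), y)` at which `g` enters `J(ρ, y)`. -/
def gparam (p : {p : ProbabilityMeasure Int11 × ℝ // 0 < Qm p.1}) : GParam :=
  (⟨Mm p.1.1, abs_le.1 (abs_Mm_le _)⟩, ⟨Qm p.1.1, p.2, Qm_le_one _⟩, p.1.2)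

lemma continuous_gparam : Continuous gparam := by
  unfold gparam
  have := continuous_Mm
  have := continuous_Qm
  fun_prop

/-- The nonnegative integrand `gbound - log g`, integrated against `ρ`. -/
def gdefect (β lam : ℝ) (ρ : ProbabilityMeasure Int11) (y : ℝ) : ℝ≥0∞ :=
  ∫⁻ x, ENNReal.ofReal (gbound β lam y - Real.log (gdens β lam x (Mm ρ) (Qm ρ) y))
    ∂(ρ : Measure Int11)

lemma lowerSemicontinuous_gdefect {β : ℝ} (hβ : 0 < β) (lam : ℝ) :
    LowerSemicontinuous fun p : {p : ProbabilityMeasure Int11 × ℝ // 0 < Qm p.1} =>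
      gdefect β lam p.1.1 p.1.2 := by
  have hf : Continuous fun p : Int11 × GParam =>
      gbound β lam p.2.2.2 - Real.log (gdens β lam p.1 p.2.1 p.2.2.1 p.2.2.2) := by
    refine Continuous.sub ?_ (continuous_log_gdens hβ lam)
    unfold gbound
    fun_prop
  have hμ : Continuous fun p : {p : ProbabilityMeasure Int11 × ℝ // 0 < Qm p.1} =>
      p.1.1.prod (diracProba (gparam p)) :=
    (ProbabilityMeasure.continuous_prod (α := Int11) (β := GParam)).comp
      ((continuous_fst.comp continuous_subtype_val).prodMk
        (continuous_diracProba.comp continuous_gparam))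
  convert (lowerSemicontinuous_lintegral_ofReal hf).comp hμ using 1
  funext p
  have hm : Measurable fun p : Int11 × GParam => ENNReal.ofReal
      (gbound β lam p.2.2.2 - Real.log (gdens β lam p.1 p.2.1 p.2.2.1 p.2.2.2)) :=
    hf.measurable.ennreal_ofReal
  change _ = ∫⁻ x, _ ∂((p.1.1 : Measure Int11).prod (Measure.dirac (gparam p)))
  rw [lintegral_prod _ hm.aemeasurable]
  refine lintegral_congr fun x => ?_
  exact (lintegral_dirac' (gparam p) (hm.comp (measurable_prodMk_left (x := x)))).symm

lemma JE_eq {β lam : ℝ} (hβ : 0 < β) (hlam : 0 ≤ lam) {ρ : ProbabilityMeasure Int11}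
    (hρ : 0 < Qm ρ) (y : ℝ) :
    JE β lam ρ y = ((β ^ 2 * (1 - Qm ρ) ^ 2 / 2 - Real.log (2 * π * β ^ 2 * Qm ρ) / 2
      + gbound β lam y : ℝ) : EReal) + -(gdefect β lam ρ y : EReal) := by
  set A : ℝ := β ^ 2 * (1 - Qm ρ) ^ 2 / 2 - Real.log (2 * π * β ^ 2 * Qm ρ) / 2
  set K := gbound β lam y
  set l : Int11 → ℝ := fun x => Real.log (gdens β lam x (Mm ρ) (Qm ρ) y)
  have hK0 : 0 ≤ K := gbound_nonneg hβ hlam y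
  have hlK (x : Int11) : l x ≤ K :=
    log_gdens_le hβ hlam y x.2 (abs_Mm_le ρ) ⟨hρ, Qm_le_one ρ⟩
  have hlm : Measurable l :=
    ((continuous_log_gdens hβ lam).comp
      (continuous_id.prodMk (continuous_const (y := gparam ⟨(ρ, y), hρ⟩)))).measurable
  have hsum : gdefect β lam ρ y + ∫⁻ x, ENNReal.ofReal (l x) ∂(ρ : Measure Int11) =
      ENNReal.ofReal K + ∫⁻ x, ENNReal.ofReal (-l x) ∂(ρ : Measure Int11) := by
    have hc : ENNReal.ofReal K = ∫⁻ _, ENNReal.ofReal K ∂(ρ : Measure Int11) := by simp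
    rw [hc, gdefect, ← lintegral_add_right _ hlm.ennreal_ofReal,
      ← lintegral_add_left measurable_const]
    refine lintegral_congr fun x => ?_
    change ENNReal.ofReal (K - l x) + _ = _
    rcases le_total 0 (l x) with h | h
    · rw [← ENNReal.ofReal_add (sub_nonneg.2 (hlK x)) h, ENNReal.ofReal_of_nonpos (neg_nonpos.2 h)]
      simp
    · rw [← ENNReal.ofReal_add hK0 (neg_nonneg.2 h), ENNReal.ofReal_of_nonpos h, add_zero,
        sub_eq_add_neg]
  have hP : ∫⁻ x, ENNReal.ofReal (l x) ∂(ρ : Measure Int11) ≠ ⊤ := by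
    refine ne_top_of_le_ne_top (b := ENNReal.ofReal K) ENNReal.ofReal_ne_top ?_
    calc _ ≤ ∫⁻ _, ENNReal.ofReal K ∂(ρ : Measure Int11) :=
          lintegral_mono fun x => ENNReal.ofReal_le_ofReal (hlK x)
      _ = _ := by simp
  change (A : EReal) + ((∫⁻ x, ENNReal.ofReal (l x) ∂(ρ : Measure Int11) : ℝ≥0∞) : EReal)
    - ((∫⁻ x, ENNReal.ofReal (-l x) ∂(ρ : Measure Int11) : ℝ≥0∞) : EReal) = _
  generalize (∫⁻ x, ENNReal.ofReal (l x) ∂(ρ : Measure Int11)) = P at *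
  generalize (∫⁻ x, ENNReal.ofReal (-l x) ∂(ρ : Measure Int11)) = N at *
  generalize gdefect β lam ρ y = I at *
  clear_value K
  lift P to ℝ≥0 using hP
  lift K to ℝ≥0 using hK0
  rw [ENNReal.ofReal_coe_nnreal] at hsum
  induction N using ENNReal.recTopCoe with
  | top =>
    have : I = ⊤ := by simpa using hsum
    subst this
    simp
  | coe N =>
    have hI : I ≠ ⊤ := by
      rintro rfl
      simp [← ENNReal.coe_add] at hsum
    lift I to ℝ≥0 using hI
    have h : (I : ℝ) + P = K + N := by exact_mod_cast hsum
    change ((A : ℝ) : EReal) + ((P : ℝ) : EReal) - ((N : ℝ) : EReal) =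
      ((A + K : ℝ) : EReal) + -((I : ℝ) : EReal)
    rw [← EReal.coe_add, ← EReal.coe_sub, ← EReal.coe_neg, ← EReal.coe_add, EReal.coe_eq_coe_iff]
    linarith

/-- **Lemma B.2.** (a) For constants `η, β > 0` there is `C = C(β,η) < ∞` with
`J(ρ,y) ≤ C + y²/(4β²)` whenever `Q(ρ) ≥ η`. (b) `J` is upper semi-continuous on
`{ρ : Q(ρ) > 0} × ℝ` (weak topology on probability measures). -/
theorem J_bound_and_usc (β lam : ℝ) (hβ : 0 < β) (hlam : 0 ≤ lam) :
    (∀ η : ℝ, 0 < η → ∃ C : ℝ, ∀ (ρ : ProbabilityMeasure Int11) (y : ℝ),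
      η ≤ Qm ρ → JE β lam ρ y ≤ ((C + y ^ 2 / (4 * β ^ 2) : ℝ) : EReal)) ∧
    UpperSemicontinuousOn (fun p : ProbabilityMeasure Int11 × ℝ => JE β lam p.1 p.2)
      {p | 0 < Qm p.1} := by
  constructor
  · intro η hη
    refine ⟨β ^ 2 / 2 - Real.log (2 * π * β ^ 2 * η) / 2
      + (6 * β ^ 2 + 2 * (β * lam + β ^ 2)), fun ρ y hρ => ?_⟩
    have hQ : 0 < Qm ρ := hη.trans_le hρ
    rw [JE_eq hβ hlam hQ]
    refine (add_le_of_nonpos_right (by simp [EReal.coe_ennreal_nonneg])).trans (EReal.coe_le_coe_iff.2 ?_)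
    have h1 : Real.log (2 * π * β ^ 2 * η) ≤ Real.log (2 * π * β ^ 2 * Qm ρ) :=
      Real.log_le_log (by positivity) (by gcongr)
    have h2 : β ^ 2 * (1 - Qm ρ) ^ 2 ≤ β ^ 2 :=
      mul_le_of_le_one_right (by positivity)
        (pow_le_one₀ (by linarith [Qm_le_one ρ]) (by linarith))
    unfold gbound
    linarith
  · rw [← upperSemicontinuousOn_iff_restrict]
    have hQ : Continuous fun p : {p : ProbabilityMeasure Int11 × ℝ // 0 < Qm p.1} => Qm p.1.1 :=
      continuous_Qm.comp (continuous_fst.comp continuous_subtype_val)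
    have hA : Continuous fun p : {p : ProbabilityMeasure Int11 × ℝ // 0 < Qm p.1} =>
        ((β ^ 2 * (1 - Qm p.1.1) ^ 2 / 2 - Real.log (2 * π * β ^ 2 * Qm p.1.1) / 2
          + gbound β lam p.1.2 : ℝ) : EReal) := by
      refine continuous_coe_real_ereal.comp (Continuous.add (Continuous.sub (by fun_prop)
        (Continuous.div_const (Continuous.log (by fun_prop) fun p => ?_) _)) ?_)
      · have := p.2
        positivity
      · unfold gbound
        fun_prop
    have hI : UpperSemicontinuous fun p : {p : ProbabilityMeasure Int11 × ℝ // 0 < Qm p.1} =>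
        -(gdefect β lam p.1.1 p.1.2 : EReal) :=
      (continuous_neg.comp continuous_coe_ennreal_ereal).comp_lowerSemicontinuous_antitone
        (lowerSemicontinuous_gdefect hβ lam)
        fun a b hab => EReal.neg_le_neg_iff.2 (EReal.coe_ennreal_le_coe_ennreal_iff.2 hab)
    convert hA.upperSemicontinuous.add' hI fun p =>
      EReal.continuousAt_add (.inl (EReal.coe_ne_top _)) (.inl (EReal.coe_ne_bot _)) using 1
    funext p
    exact JE_eq hβ hlam p.2 p.1.2

end
end
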